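/- arXiv:2510.05628 — 2 statements merged into one kernel-verified Lean document; each statement's English description precedes it below -/
import Mathlib

section
/- Let X be a nonempty finite set of points of ℙ¹×ℙ¹ with defining ideal I_X ⊆ R, and let G be a finite set of nonzero bihomogeneous polynomials that minimally generates I_X. Then there is no partition G = A ⊔ B with A ≠ ∅ and B ≠ ∅ such that Ideal.span A = I_Y and Ideal.span B = I_Z for some nonempty finite sets of points Y and Z of ℙ¹×ℙ¹. -/
/- Common setup: R = ℂ[x₀,x₁,y₀,y₁] as MvPolynomial (Fin 4) ℂ with
   x₀ = X 0, x₁ = X 1, y₀ = X 2, y₁ = X 3.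
   `Hf a` is the horizontal form a₁x₀ - a₀x₁ of the point a = [a₀:a₁] ∈ ℙ¹;
   `Vf b` is the vertical form b₁y₀ - b₀y₁;
   `cross a b ≠ 0` says the (nonzero) pairs a, b are non-proportional,
   i.e. define distinct points of ℙ¹. -/

open MvPolynomial

noncomputable section

abbrev R : Type := MvPolynomial (Fin 4) ℂ

def Hf (a : ℂ × ℂ) : R := C a.2 * X 0 - C a.1 * X 1

def Vf (b : ℂ × ℂ) : R := C b.2 * X 2 - C b.1 * X 3

def cross (a b : ℂ × ℂ) : ℂ := a.1 * b.2 - a.2 * b.1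

/-- The defining ideal of the point P = A×B of ℙ¹×ℙ¹. -/
def Ipt (P : (ℂ × ℂ) × (ℂ × ℂ)) : Ideal R := Ideal.span {Hf P.1, Vf P.2}

/-- The defining ideal of a finite set of points (I_∅ = R = ⊤). -/
def Ipts (X : Finset ((ℂ × ℂ) × (ℂ × ℂ))) : Ideal R := X.inf Ipt

/-- The defining ideal of a set of points (I_∅ = R = ⊤). -/
def IptsSet (W : Set ((ℂ × ℂ) × (ℂ × ℂ))) : Ideal R := ⨅ P ∈ W, Ipt P

/-- Bihomogeneous: homogeneous separately in x₀,x₁ and in y₀,y₁. -/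
def Bihom (f : R) : Prop :=
  ∃ a b : ℕ, IsWeightedHomogeneous (![1,1,0,0] : Fin 4 → ℕ) f a ∧
    IsWeightedHomogeneous (![0,0,1,1] : Fin 4 → ℕ) f b

/-- `G` minimally generates `I`. -/
def MinGen (G : Finset R) (I : Ideal R) : Prop :=
  Ideal.span (G : Set R) = I ∧ ∀ g ∈ G, Ideal.span ((G : Set R) \ {g}) ≠ I

/-- Setting the y-variables to zero. -/
def phi : R →ₐ[ℂ] R := aeval ![X 0, X 1, 0, 0]

lemma phi_Hf (a : ℂ × ℂ) : phi (Hf a) = Hf a := by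
  simp [phi, Hf, algebraMap_eq]

lemma phi_Vf (a : ℂ × ℂ) : phi (Vf a) = 0 := by
  simp [phi, Vf]

lemma phi_bihom {g : R} (hg : Bihom g) (h : phi g ≠ 0) : phi g = g := by
  obtain ⟨a, b, -, hb⟩ := hg
  have key : ∀ d ∈ g.support, d 2 + d 3 = b := by
    intro d hd
    have := hb (mem_support_iff.mp hd)
    simpa [Finsupp.weight_apply, Finsupp.sum_fintype, Fin.sum_univ_four] using this
  have hmon : ∀ (d : Fin 4 →₀ ℕ) (c : ℂ), phi (monomial d c) =
      C c * ((X 0) ^ d 0 * (X 1) ^ d 1 * 0 ^ d 2 * 0 ^ d 3) := by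
    intro d c
    rw [phi, aeval_monomial, Finsupp.prod_fintype _ _ (by simp), algebraMap_eq]
    simp [Fin.prod_univ_four]
  have hmon2 : ∀ (d : Fin 4 →₀ ℕ) (c : ℂ), (monomial d c : R) =
      C c * ((X 0) ^ d 0 * (X 1) ^ d 1 * (X 2) ^ d 2 * (X 3) ^ d 3) := by
    intro d c
    rw [monomial_eq, Finsupp.prod_fintype _ _ (by simp)]
    simp [Fin.prod_univ_four]
  have hsum : phi g = ∑ d ∈ g.support, phi (monomial d (coeff d g)) := by
    conv_lhs => rw [g.as_sum, map_sum]
  rcases Nat.eq_zero_or_pos b with rfl | hpos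
  · rw [hsum]
    conv_rhs => rw [g.as_sum]
    refine Finset.sum_congr rfl fun d hd => ?_
    have := key d hd
    have h2 : d 2 = 0 := by omega
    have h3 : d 3 = 0 := by omega
    rw [hmon, hmon2, h2, h3]
    simp
  · exfalso
    apply h
    rw [hsum]
    refine Finset.sum_eq_zero fun d hd => ?_
    have := key d hd
    rw [hmon]
    rcases Nat.eq_zero_or_pos (d 2) with h2 | h2
    · have h3 : d 3 ≠ 0 := by omega
      simp [h3]
    · simp [h2.ne']

lemma bihom_homog {g : R} (hg : Bihom g) : ∃ n, g.IsHomogeneous n := by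
  obtain ⟨a, b, ha, hb⟩ := hg
  refine ⟨a + b, fun d hd => ?_⟩
  have h1 := ha hd
  have h2 := hb hd
  simp [Finsupp.weight_apply, Finsupp.sum_fintype, Fin.sum_univ_four] at h1 h2 ⊢
  omega

lemma Hf_ne_zero {a : ℂ × ℂ} (ha : a ≠ 0) : Hf a ≠ 0 := by
  intro h
  apply ha
  have h1 := congrArg (eval ![1, 0, 0, 0]) h
  have h2 := congrArg (eval ![0, 1, 0, 0]) h
  simp [Hf] at h1 h2
  exact Prod.ext h2 h1

lemma Hf_homog (a : ℂ × ℂ) : (Hf a).IsHomogeneous 1 := by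
  have h (c : ℂ) (i : Fin 4) : (C c * X i : R).IsHomogeneous 1 := by
    simpa using (isHomogeneous_C (Fin 4) c).mul (isHomogeneous_X ℂ i)
  exact (h _ _).sub (h _ _)

lemma Hf_prime {a : ℂ × ℂ} (ha : a ≠ 0) : Prime (Hf a) := by
  rw [← irreducible_iff_prime]
  apply irreducible_of_totalDegree_eq_one ((Hf_homog a).totalDegree (Hf_ne_zero ha))
  intro x hx
  rw [isUnit_iff_ne_zero]
  rintro rfl
  apply Hf_ne_zero ha
  ext i
  simpa using hx i

/-- The generator of the pure-x part of an ideal of points. -/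
lemma exists_F (S : Finset ((ℂ × ℂ) × (ℂ × ℂ))) (hS : ∀ P ∈ S, P.1 ≠ 0 ∧ P.2 ≠ 0) :
    ∃ F : R, F ≠ 0 ∧ phi F = F ∧ (∃ m, F.IsHomogeneous m) ∧
      ∀ g, F ∣ g ↔ ∀ P ∈ S, Hf P.1 ∣ g := by
  classical
  induction S using Finset.induction_on with
  | empty => exact ⟨1, one_ne_zero, map_one _, ⟨0, isHomogeneous_one _ _⟩, by simp⟩
  | insert P S hP ih =>
    obtain ⟨F, h0, hphi, ⟨m, hm⟩, hF⟩ := ih fun Q hQ => hS Q (Finset.mem_insert_of_mem hQ)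
    have hP1 := (hS P (Finset.mem_insert_self _ _)).1
    by_cases hd : Hf P.1 ∣ F
    · refine ⟨F, h0, hphi, ⟨m, hm⟩, fun g => ?_⟩
      rw [Finset.forall_mem_insert, ← hF]
      exact ⟨fun h => ⟨hd.trans h, h⟩, fun h => h.2⟩
    · refine ⟨F * Hf P.1, mul_ne_zero h0 (Hf_ne_zero hP1), by rw [map_mul, hphi, phi_Hf],
        ⟨_, hm.mul (Hf_homog _)⟩, fun g => ?_⟩
      rw [Finset.forall_mem_insert, ← hF]
      refine ⟨fun h => ⟨(dvd_mul_left _ _).trans h, (dvd_mul_right _ _).trans h⟩, ?_⟩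
      rintro ⟨h1, u, rfl⟩
      exact mul_dvd_mul_left _ (((Hf_prime hP1).dvd_or_dvd h1).resolve_left hd)

lemma mem_Ipts {S : Finset ((ℂ × ℂ) × (ℂ × ℂ))} {g : R} :
    g ∈ Ipts S ↔ ∀ P ∈ S, g ∈ Ipt P := by
  simp [Ipts, Submodule.mem_finsetInf]

lemma pure_mem_Ipt {P : (ℂ × ℂ) × (ℂ × ℂ)} {g : R} (hg : phi g = g) :
    g ∈ Ipt P ↔ Hf P.1 ∣ g := by
  constructor
  · intro h
    obtain ⟨c, d, h⟩ := Ideal.mem_span_pair.mp h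
    rw [← hg, ← h, map_add, map_mul, map_mul, phi_Hf, phi_Vf, mul_zero, add_zero]
    exact dvd_mul_left _ _
  · rintro ⟨c, rfl⟩
    exact Ideal.mul_mem_right _ _ (Ideal.subset_span (by simp))

/-- A bihomogeneous generating set contains a nonzero pure-x element. -/
lemma exists_pure {S : Finset ((ℂ × ℂ) × (ℂ × ℂ))} (hS : ∀ P ∈ S, P.1 ≠ 0 ∧ P.2 ≠ 0)
    {A : Finset R} (hA : ∀ g ∈ A, g ≠ 0 ∧ Bihom g) (h : Ideal.span (A : Set R) = Ipts S) :
    ∃ g ∈ A, phi g = g := by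
  obtain ⟨F, h0, hphi, -, hF⟩ := exists_F S hS
  by_contra! hcon
  have hz : ∀ g ∈ A, phi g = 0 := fun g hg => by
    by_contra hne
    exact hcon g hg (phi_bihom (hA g hg).2 hne)
  have hle : Ideal.span (A : Set R) ≤ RingHom.ker phi := by
    rw [Ideal.span_le]
    exact fun g hg => hz g hg
  have hmem : F ∈ Ipts S :=
    mem_Ipts.mpr fun P hP => (pure_mem_Ipt hphi).mpr ((hF F).mp dvd_rfl P hP)
  rw [← h] at hmem
  have := hle hmem
  rw [RingHom.mem_ker, hphi] at this
  exact h0 this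

lemma homog_dvd_const {F u : R} {m n : ℕ} (h0 : F ≠ 0) (hF : F.IsHomogeneous m)
    (hg : (F * u).IsHomogeneous n) (hu : constantCoeff u ≠ 0) : F * u ∣ F := by
  have hc : homogeneousComponent m (F * u) = F * C (constantCoeff u) := by
    letI : GradedAlgebra (homogeneousSubmodule (Fin 4) ℂ) := MvPolynomial.gradedAlgebra
    have key := DirectSum.coe_decompose_mul_add_of_left_mem (homogeneousSubmodule (Fin 4) ℂ)
      (i := m) (j := 0) (a := F) (b := u) hF
    have hd (p : R) (i : ℕ) : (DirectSum.decompose (homogeneousSubmodule (Fin 4) ℂ) p i : R) =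
        homogeneousComponent i p := decomposition.decompose'_apply p i
    rw [hd, hd, homogeneousComponent_zero, add_zero] at key
    rw [key, constantCoeff_eq]
  have hne : F * C (constantCoeff u) ≠ 0 := mul_ne_zero h0 (by simpa using hu)
  have hmn : m = n := by
    by_contra hmn
    rw [homogeneousComponent_of_mem hg, if_neg hmn] at hc
    exact hne hc.symm
  rw [homogeneousComponent_of_mem hg, if_pos hmn] at hc
  rw [hc]
  refine ⟨C (constantCoeff u)⁻¹, ?_⟩
  rw [mul_assoc, ← C_mul, mul_inv_cancel₀ hu, C_1, mul_one]

lemma exists_gen {S : Finset ((ℂ × ℂ) × (ℂ × ℂ))} (hS : ∀ P ∈ S, P.1 ≠ 0 ∧ P.2 ≠ 0)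
    {G : Finset R} (hG : ∀ g ∈ G, g ≠ 0 ∧ Bihom g) (h : Ideal.span (G : Set R) = Ipts S) :
    ∃ g₀ ∈ G, ∀ g ∈ G, phi g = g → g₀ ∣ g := by
  obtain ⟨F, h0, hphi, ⟨m, hm⟩, hF⟩ := exists_F S hS
  have hdvd : ∀ g ∈ G, phi g = g → F ∣ g := fun g hg hp => (hF g).mpr fun P hP =>
    (pure_mem_Ipt hp).mp (mem_Ipts.mp (h ▸ Ideal.subset_span hg) P hP)
  suffices hs : ∃ g₀ ∈ G, g₀ ∣ F by
    obtain ⟨g₀, hg, hd⟩ := hs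
    exact ⟨g₀, hg, fun g hg hp => hd.trans (hdvd g hg hp)⟩
  by_contra! hcon
  -- every pure generator is F times something without constant term
  have hgen : ∀ g ∈ G, ∃ u, phi g = F * u ∧ constantCoeff u = 0 := by
    intro g hg
    by_cases hz : phi g = 0
    · exact ⟨0, by simp [hz], map_zero _⟩
    have hp := phi_bihom (hG g hg).2 hz
    obtain ⟨u, hu⟩ := hdvd g hg hp
    refine ⟨u, by rw [hp, hu], ?_⟩
    by_contra hne
    obtain ⟨n, hn⟩ := bihom_homog (hG g hg).2
    apply hcon g hg
    rw [hu] at hn ⊢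
    exact homog_dvd_const h0 hm hn hne
  have hle : Ideal.span (G : Set R) ≤
      (Ideal.span {F} * RingHom.ker (constantCoeff : R →+* ℂ)).comap phi := by
    rw [Ideal.span_le]
    intro g hg
    obtain ⟨u, hu, hu0⟩ := hgen g hg
    exact Ideal.mem_span_singleton_mul.mpr ⟨u, hu0, hu.symm⟩
  have hmem : F ∈ Ipts S :=
    mem_Ipts.mpr fun P hP => (pure_mem_Ipt hphi).mpr ((hF F).mp dvd_rfl P hP)
  rw [← h] at hmem
  have hF2 := hle hmem
  rw [Ideal.mem_comap, hphi] at hF2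
  obtain ⟨u, hu, hFu⟩ := Ideal.mem_span_singleton_mul.mp hF2
  have : u = 1 := mul_left_cancel₀ h0 (by rw [hFu, mul_one])
  rw [this, RingHom.mem_ker, map_one] at hu
  exact one_ne_zero hu

/-- Lemma 3.1 (no splitting into two ideals of points): for a nonempty finite set X of
points of ℙ¹×ℙ¹ and a minimal generating set G of nonzero bihomogeneous polynomials of
I_X, there is no partition G = A ⊔ B with A, B nonempty such that span A and span B are
both defining ideals of nonempty finite sets of points of ℙ¹×ℙ¹. -/
theorem statement0 (Xpts : Finset ((ℂ × ℂ) × (ℂ × ℂ))) (hne : Xpts.Nonempty)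
    (hval : ∀ P ∈ Xpts, P.1 ≠ 0 ∧ P.2 ≠ 0)
    (G : Finset R) (hG : ∀ g ∈ G, g ≠ 0 ∧ Bihom g)
    (hmin : MinGen G (Ipts Xpts)) :
    ¬ ∃ A B : Finset R, A ∪ B = G ∧ Disjoint A B ∧ A.Nonempty ∧ B.Nonempty ∧
      (∃ Y : Finset ((ℂ × ℂ) × (ℂ × ℂ)), Y.Nonempty ∧ (∀ P ∈ Y, P.1 ≠ 0 ∧ P.2 ≠ 0) ∧
        Ideal.span (A : Set R) = Ipts Y) ∧
      (∃ Z : Finset ((ℂ × ℂ) × (ℂ × ℂ)), Z.Nonempty ∧ (∀ P ∈ Z, P.1 ≠ 0 ∧ P.2 ≠ 0) ∧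
        Ideal.span (B : Set R) = Ipts Z) := by
  classical
  rintro ⟨A, B, hAB, hdis, -, -, ⟨Y, -, hY, hAY⟩, ⟨Z, -, hZ, hBZ⟩⟩
  have hAG : A ⊆ G := hAB ▸ Finset.subset_union_left
  have hBG : B ⊆ G := hAB ▸ Finset.subset_union_right
  obtain ⟨a, ha, hpa⟩ := exists_pure hY (fun g hg => hG g (hAG hg)) hAY
  obtain ⟨b, hb, hpb⟩ := exists_pure hZ (fun g hg => hG g (hBG hg)) hBZ
  obtain ⟨g₀, hg₀, hdiv⟩ := exists_gen hval hG hmin.1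
  have hab : a ≠ b := fun h => Finset.disjoint_left.mp hdis ha (h ▸ hb)
  have main : ∀ g ∈ G, phi g = g → g = g₀ := by
    intro g hg hp
    by_contra hne
    apply hmin.2 g hg
    rw [← hmin.1]
    refine le_antisymm (Ideal.span_mono Set.sdiff_subset) (Ideal.span_le.mpr fun x hx => ?_)
    by_cases hxg : x = g
    · rw [hxg]
      exact Ideal.mem_of_dvd _ (hdiv g hg hp)
        (Ideal.subset_span ⟨hg₀, fun h => hne (Set.mem_singleton_iff.mp h).symm⟩)
    · exact Ideal.subset_span ⟨hx, hxg⟩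
  exact hab ((main a (hAG ha) hpa).trans (main b (hBG hb) hpb).symm)
end
end

section
/- Given staircase data, let {f₀,…,f_r} = A ⊔ B be any partition of the staircase generators with A and B both nonempty, let c be its cut number, and set J = Ideal.span A and K = Ideal.span B. Then J ⊓ K is minimally generated by exactly c elements; equivalently, μ(J ⊓ K) = dim_ℂ ((J ⊓ K) / (m·(J ⊓ K))) = c. -/
/- Common setup: R = ℂ[x₀,x₁,y₀,y₁] as MvPolynomial (Fin 4) ℂ with
   x₀ = X 0, x₁ = X 1, y₀ = X 2, y₁ = X 3.
   `Hf a` is the horizontal form a₁x₀ - a₀x₁ of the point a = [a₀:a₁] ∈ ℙ¹;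
   `Vf b` is the vertical form b₁y₀ - b₀y₁;
   `cross a b ≠ 0` says the (nonzero) pairs a, b are non-proportional,
   i.e. define distinct points of ℙ¹. -/

open MvPolynomial

noncomputable section

/-- Staircase data: r ≥ 1, 0 = t₀ < t₁ < ⋯ < t_r, 0 = s₀ < s₁ < ⋯ < s_r,
    pairwise distinct points A₁,…,A_{t_r} of ℙ¹ and pairwise distinct points
    B₁,…,B_{s_r} of ℙ¹ (all indexed starting at 1). -/
structure Staircase where
  r : ℕ
  t : ℕ → ℕ
  s : ℕ → ℕ
  A : ℕ → ℂ × ℂ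
  B : ℕ → ℂ × ℂ
  hr : 1 ≤ r
  ht0 : t 0 = 0
  hs0 : s 0 = 0
  ht : ∀ k, k < r → t k < t (k + 1)
  hs : ∀ k, k < r → s k < s (k + 1)
  hA0 : ∀ i ∈ Finset.Icc 1 (t r), A i ≠ 0
  hB0 : ∀ j ∈ Finset.Icc 1 (s r), B j ≠ 0
  hAd : ∀ i ∈ Finset.Icc 1 (t r), ∀ i' ∈ Finset.Icc 1 (t r), i ≠ i' → cross (A i) (A i') ≠ 0
  hBd : ∀ j ∈ Finset.Icc 1 (s r), ∀ j' ∈ Finset.Icc 1 (s r), j ≠ j' → cross (B j) (B j') ≠ 0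

/-- The staircase generator f_k = H₁⋯H_{t_k} · V₁⋯V_{s_{r-k}}. -/
def stairGen (S : Staircase) (k : ℕ) : R :=
  (∏ i ∈ Finset.Icc 1 (S.t k), Hf (S.A i)) * ∏ j ∈ Finset.Icc 1 (S.s (S.r - k)), Vf (S.B j)

/-- μ(I): the minimal number of generators of the ideal I. -/
def mu (I : Ideal R) : ℕ := sInf {n | ∃ G : Finset R, G.card = n ∧ Ideal.span (G : Set R) = I}


/-! ### Basic facts on the linear forms -/

lemma Vf_ne_zero {b : ℂ × ℂ} (hb : b ≠ 0) : Vf b ≠ 0 := by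
  intro h
  have h1 := congrArg (eval (![0, 0, 1, 0] : Fin 4 → ℂ)) h
  have h2 := congrArg (eval (![0, 0, 0, 1] : Fin 4 → ℂ)) h
  simp [Vf] at h1 h2
  exact hb (Prod.ext h2 h1)

lemma Hf_exists_eval {a : ℂ × ℂ} (ha : a ≠ 0) :
    ∃ x y : ℂ, eval (![x, y, 0, 0] : Fin 4 → ℂ) (Hf a) ≠ 0 := by
  by_cases h : a.2 = 0
  · refine ⟨0, 1, ?_⟩
    have : a.1 ≠ 0 := fun h' => ha (Prod.ext h' h)
    simpa [Hf] using this
  · refine ⟨1, 0, ?_⟩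
    simpa [Hf] using h

lemma Vf_irreducible {b : ℂ × ℂ} (hb : b ≠ 0) : Irreducible (Vf b) := by
  have hne := Vf_ne_zero hb
  have hhom : (Vf b).IsHomogeneous 1 := by
    unfold Vf
    apply IsHomogeneous.sub
    · simpa using (isHomogeneous_C (Fin 4) b.2).mul (isHomogeneous_X ℂ (2 : Fin 4))
    · simpa using (isHomogeneous_C (Fin 4) b.1).mul (isHomogeneous_X ℂ (3 : Fin 4))
  apply irreducible_of_totalDegree_eq_one (hhom.totalDegree hne)
  intro x hx
  rw [isUnit_iff_ne_zero]
  rintro rfl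
  apply hne
  ext i
  simpa using hx i

lemma Vf_Hf_relPrime {a b : ℂ × ℂ} (ha : a ≠ 0) (hb : b ≠ 0) : IsRelPrime (Vf b) (Hf a) := by
  rw [(Vf_irreducible hb).isRelPrime_iff_not_dvd]
  rintro ⟨q, hq⟩
  obtain ⟨x, y, h⟩ := Hf_exists_eval ha
  apply h
  rw [hq]
  simp [Vf]

/-! ### Staircase products -/

namespace Staircase

variable (S : Staircase)

lemma t_mono {i j : ℕ} (hij : i ≤ j) (hj : j ≤ S.r) : S.t i ≤ S.t j := by
  induction j, hij using Nat.le_induction with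
  | base => exact le_rfl
  | succ n hn ih => exact (ih (by omega)).trans (S.ht n (by omega)).le

lemma s_mono {i j : ℕ} (hij : i ≤ j) (hj : j ≤ S.r) : S.s i ≤ S.s j := by
  induction j, hij using Nat.le_induction with
  | base => exact le_rfl
  | succ n hn ih => exact (ih (by omega)).trans (S.hs n (by omega)).le

lemma t_lt {i j : ℕ} (hij : i < j) (hj : j ≤ S.r) : S.t i < S.t j :=
  (S.ht i (by omega)).trans_le (S.t_mono hij hj)

lemma s_lt {i j : ℕ} (hij : i < j) (hj : j ≤ S.r) : S.s i < S.s j :=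
  (S.hs i (by omega)).trans_le (S.s_mono hij hj)

/-- Product of the first `t k` horizontal forms. -/
def P (k : ℕ) : R := ∏ i ∈ Finset.Icc 1 (S.t k), Hf (S.A i)

/-- Product of the first `s k` vertical forms. -/
def Q (k : ℕ) : R := ∏ j ∈ Finset.Icc 1 (S.s k), Vf (S.B j)

/-- The least common multiple of `f_k` and `f_{k+1}`. -/
def L (k : ℕ) : R := S.P (k + 1) * S.Q (S.r - k)

lemma P_ne {k : ℕ} (hk : k ≤ S.r) : S.P k ≠ 0 := by
  refine Finset.prod_ne_zero_iff.2 fun i hi => Hf_ne_zero (S.hA0 i ?_)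
  have := S.t_mono hk le_rfl
  simp at hi ⊢; omega

lemma Q_ne {k : ℕ} (hk : k ≤ S.r) : S.Q k ≠ 0 := by
  refine Finset.prod_ne_zero_iff.2 fun i hi => Vf_ne_zero (S.hB0 i ?_)
  have := S.s_mono hk le_rfl
  simp at hi ⊢; omega

lemma P_dvd {i j : ℕ} (hij : i ≤ j) (hj : j ≤ S.r) : S.P i ∣ S.P j :=
  Finset.prod_dvd_prod_of_subset _ _ _ (Finset.Icc_subset_Icc le_rfl (S.t_mono hij hj))

lemma Q_dvd {i j : ℕ} (hij : i ≤ j) (hj : j ≤ S.r) : S.Q i ∣ S.Q j :=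
  Finset.prod_dvd_prod_of_subset _ _ _ (Finset.Icc_subset_Icc le_rfl (S.s_mono hij hj))

lemma Q_relPrime_P {i j : ℕ} (hi : i ≤ S.r) (hj : j ≤ S.r) : IsRelPrime (S.Q i) (S.P j) := by
  refine IsRelPrime.prod_left fun a ha => IsRelPrime.prod_right fun b hb =>
    Vf_Hf_relPrime (S.hA0 _ ?_) (S.hB0 _ ?_)
  · have := S.t_mono hj le_rfl
    simp at hb ⊢; omega
  · have := S.s_mono hi le_rfl
    simp at ha ⊢; omega

lemma gen_eq (k : ℕ) : stairGen S k = S.P k * S.Q (S.r - k) := rfl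

lemma gen_dvd_L {k : ℕ} (hk : k < S.r) : stairGen S k ∣ S.L k := by
  rw [gen_eq]
  exact mul_dvd_mul_right (S.P_dvd (Nat.le_succ k) hk) _

lemma gen_succ_dvd_L {k : ℕ} (hk : k < S.r) : stairGen S (k + 1) ∣ S.L k := by
  rw [gen_eq]
  exact mul_dvd_mul_left _ (S.Q_dvd (by omega) (by omega))

/-- Divisibility step: the last coefficient of a syzygy. -/
lemma last_dvd {n : ℕ} (hn : n < S.r) (a : ℕ → R)
    (h : ∑ k ∈ Finset.range (n + 2), a k * stairGen S k = 0) :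
    S.L n ∣ a (n + 1) * stairGen S (n + 1) := by
  have hd : S.Q (S.r - n) ∣ a (n + 1) * stairGen S (n + 1) := by
    rw [Finset.sum_range_succ] at h
    rw [eq_neg_of_add_eq_zero_right h, dvd_neg]
    refine Finset.dvd_sum fun k hk => ?_
    have hk' : k ≤ n := by simp at hk; omega
    rw [gen_eq]
    exact ((S.Q_dvd (by omega) (by omega)).mul_left _).mul_left _
  have hP : S.P (n + 1) ∣ a (n + 1) * stairGen S (n + 1) := by
    rw [gen_eq]
    exact (dvd_mul_right _ _).mul_left _
  exact (S.Q_relPrime_P (by omega) (by omega)).symm.mul_dvd hP hd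

/-- Key lemma: the `K`-part of a syzygy lies in the ideal of the cut lcm's. -/
lemma syz_part (K : Finset ℕ) (n : ℕ) (hn : n ≤ S.r) : ∀ a : ℕ → R,
    ∑ k ∈ Finset.range (n + 1), a k * stairGen S k = 0 →
    ∑ k ∈ Finset.range (n + 1), (if k ∈ K then a k * stairGen S k else 0) ∈
      Ideal.span (S.L '' ↑((Finset.range S.r).filter fun k => ¬((k ∈ K) ↔ (k + 1 ∈ K)))) := by
  induction n with
  | zero =>
    intro a h
    simp only [zero_add, Finset.sum_range_one] at h ⊢
    rw [h]; simp
  | succ n ih =>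
    intro a h
    obtain ⟨c, hc⟩ := S.last_dvd (by omega) a h
    obtain ⟨d, hd⟩ := S.gen_dvd_L (k := n) (by omega)
    have e : ∀ k ∈ Finset.range n, Function.update a n (a n + c * d) k = a k := by
      intro k hk
      have : k ≠ n := by simp at hk; omega
      simp [this]
    have key := ih (by omega) (Function.update a n (a n + c * d)) (by
      rw [Finset.sum_range_succ, Finset.sum_congr rfl fun k hk => by rw [e k hk]]
      rw [Finset.sum_range_succ, Finset.sum_range_succ, hc, hd] at h
      rw [← h]; simp; ring)
    rw [Finset.sum_range_succ, Finset.sum_congr rfl fun k hk => by rw [e k hk]] at key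
    simp only [Function.update_self] at key
    rw [Finset.sum_range_succ, Finset.sum_range_succ, hc]
    have hcut : ¬((n ∈ K) ↔ (n + 1 ∈ K)) → S.L n ∈ Ideal.span (S.L ''
        ↑((Finset.range S.r).filter fun k => ¬((k ∈ K) ↔ (k + 1 ∈ K)))) := by
      intro hh
      refine Ideal.subset_span ⟨n, ?_, rfl⟩
      simp only [Finset.coe_filter, Finset.mem_range, Set.mem_ofPred_eq]
      exact ⟨by omega, hh⟩
    have e2 : (a n + c * d) * stairGen S n = a n * stairGen S n + c * S.L n := by rw [hd]; ring
    rw [e2] at key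
    by_cases h1 : n ∈ K <;> by_cases h2 : n + 1 ∈ K <;> simp only [h1, h2, if_true, if_false] at key ⊢
    · convert key using 1; ring
    · have := Ideal.sub_mem _ key (Ideal.mul_mem_left _ c (hcut (by tauto)))
      convert this using 1; ring
    · have := Ideal.add_mem _ key (Ideal.mul_mem_left _ c (hcut (by tauto)))
      convert this using 1; ring
    · convert key using 1; ring

/-! ### Minimality -/

/-- Specialisation along a line through the origin. -/
def spec (a b : ℂ × ℂ) : R →ₐ[ℂ] Polynomial ℂ :=
  aeval (![Polynomial.C a.1 * Polynomial.X, Polynomial.C a.2 * Polynomial.X,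
    Polynomial.C b.1 * Polynomial.X, Polynomial.C b.2 * Polynomial.X] : Fin 4 → Polynomial ℂ)

lemma spec_Hf (a b c : ℂ × ℂ) :
    spec a b (Hf c) = Polynomial.C (-cross c a) * Polynomial.X := by
  simp [spec, Hf, cross, MvPolynomial.algHom_C]
  ring

lemma spec_Vf (a b c : ℂ × ℂ) :
    spec a b (Vf c) = Polynomial.C (-cross c b) * Polynomial.X := by
  simp [spec, Vf, cross, MvPolynomial.algHom_C]
  ring

lemma spec_const (a b : ℂ × ℂ) (g : R) :
    (spec a b g).eval 0 = constantCoeff g := by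
  have : (Polynomial.evalRingHom (0 : ℂ)).comp (spec a b : R →+* Polynomial ℂ)
      = (constantCoeff : R →+* ℂ) := by
    apply MvPolynomial.ringHom_ext
    · intro r; simp [spec]
    · intro i; fin_cases i <;> simp [spec]
  exact congrArg (fun f => f g) this

/-- A point of the line off finitely many given points, and equal to the next one if it exists. -/
lemma exists_point (A : ℕ → ℂ × ℂ) (N n : ℕ) (h0 : ∀ i ∈ Finset.Icc 1 N, A i ≠ 0)
    (hd : ∀ i ∈ Finset.Icc 1 N, ∀ j ∈ Finset.Icc 1 N, i ≠ j → cross (A i) (A j) ≠ 0)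
    (hn : n ≤ N) :
    ∃ a : ℂ × ℂ, (∀ i ∈ Finset.Icc 1 n, cross (A i) a ≠ 0) ∧
      (n < N → cross (A (n + 1)) a = 0) := by
  rcases hn.lt_or_eq with h | rfl
  · refine ⟨A (n + 1), fun i hi => hd _ ?_ _ ?_ ?_, fun _ => ?_⟩
    · simp at hi ⊢; omega
    · simp; omega
    · simp at hi; omega
    · simp [cross]; ring
  · have hp : (∏ i ∈ Finset.Icc 1 n, (Polynomial.C (A i).1 * Polynomial.X
        - Polynomial.C (A i).2)) ≠ (0 : Polynomial ℂ) := by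
      refine Finset.prod_ne_zero_iff.2 fun i hi h => h0 i hi ?_
      have h1 := congrArg (Polynomial.eval 0) h
      have h2 := congrArg (Polynomial.eval 1) h
      simp at h1 h2
      exact Prod.ext (by simpa [h1] using h2) h1
    obtain ⟨z, hz⟩ : ∃ z, Polynomial.eval z (∏ i ∈ Finset.Icc 1 n,
        (Polynomial.C (A i).1 * Polynomial.X - Polynomial.C (A i).2)) ≠ 0 := by
      by_contra! hcon
      exact hp (Polynomial.funext fun z => by simpa using hcon z)
    refine ⟨(1, z), fun i hi h => hz ?_, fun h => absurd h (lt_irrefl _)⟩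
    rw [Polynomial.eval_prod]
    refine Finset.prod_eq_zero hi ?_
    simpa [cross] using h

lemma const_zero (T : Finset ℕ) (hT : ∀ k ∈ T, k < S.r) (g : ℕ → R)
    (h : ∑ k ∈ T, g k * S.L k = 0) {k : ℕ} (hk : k ∈ T) : constantCoeff (g k) = 0 := by
  have hkr := hT k hk
  obtain ⟨a, ha, ha'⟩ := exists_point S.A (S.t S.r) (S.t (k + 1)) S.hA0 S.hAd
    (S.t_mono (by omega) le_rfl)
  obtain ⟨b, hb, hb'⟩ := exists_point S.B (S.s S.r) (S.s (S.r - k)) S.hB0 S.hBd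
    (S.s_mono (by omega) le_rfl)
  have hL : spec a b (S.L k) ≠ 0 := by
    unfold L P Q
    rw [map_mul, map_prod, map_prod]
    refine mul_ne_zero (Finset.prod_ne_zero_iff.2 fun i hi => ?_)
      (Finset.prod_ne_zero_iff.2 fun i hi => ?_)
    · rw [spec_Hf]
      exact mul_ne_zero (by simpa using ha i hi) Polynomial.X_ne_zero
    · rw [spec_Vf]
      exact mul_ne_zero (by simpa using hb i hi) Polynomial.X_ne_zero
  have hL' : ∀ l ∈ T, l ≠ k → spec a b (S.L l) = 0 := by
    intro l hl hlk
    have hlr := hT l hl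
    unfold L P Q
    rw [map_mul, map_prod, map_prod]
    rcases lt_or_gt_of_ne hlk with hlt | hgt
    · have h1 := S.s_lt (i := S.r - k) (j := S.r - l) (by omega) (by omega)
      have h2 := S.s_mono (i := S.r - l) (j := S.r) (by omega) (by omega)
      apply mul_eq_zero_of_right
      refine Finset.prod_eq_zero (i := S.s (S.r - k) + 1) (by simp; omega) ?_
      rw [spec_Vf, hb' (by omega)]; simp
    · have h1 := S.t_lt (i := k + 1) (j := l + 1) (by omega) (by omega)
      have h2 := S.t_mono (i := l + 1) (j := S.r) (by omega) (by omega)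
      apply mul_eq_zero_of_left
      refine Finset.prod_eq_zero (i := S.t (k + 1) + 1) (by simp; omega) ?_
      rw [spec_Hf, ha' (by omega)]; simp
  have := congrArg (spec a b) h
  rw [map_sum, Finset.sum_eq_single k] at this
  · rw [map_mul, map_zero] at this
    have h3 := (mul_eq_zero.1 this).resolve_right hL
    rw [← spec_const a b, h3]; simp
  · intro l hl hlk
    rw [map_mul, hL' l hl hlk, mul_zero]
  · intro h; exact absurd hk h

end Staircase

lemma card_le_of_const_zero (T : Finset ℕ) (L : ℕ → R)
    (h : ∀ g : ℕ → R, ∑ k ∈ T, g k * L k = 0 → ∀ k ∈ T, constantCoeff (g k) = 0)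
    (G : Finset R) (hG : Ideal.span (G : Set R) = Ideal.span (L '' ↑T)) : T.card ≤ G.card := by
  classical
  have h1 : ∀ k : T, ∃ f : R → R, ∑ x ∈ G, f x * x = L k := by
    intro k
    have : L k ∈ Ideal.span (G : Set R) := by
      rw [hG]; exact Ideal.subset_span ⟨k, k.2, rfl⟩
    obtain ⟨f, -, hf⟩ := Submodule.mem_span_finset.1 this
    exact ⟨f, hf⟩
  have h2 : ∀ x : G, ∃ f : ℕ → R, ∑ k ∈ T, f k * L k = x := by
    intro x
    have : (x : R) ∈ Ideal.span (L '' ↑T) := by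
      rw [← hG]; exact Ideal.subset_span x.2
    obtain ⟨f, hf⟩ := (Submodule.mem_span_image_finset_iff_exists_fun' R).1 this
    exact ⟨f, hf⟩
  choose M hM using h1
  choose N hN using h2
  let M0 : Matrix T G ℂ := fun k x => constantCoeff (M k x)
  let N0 : Matrix G T ℂ := fun x k => constantCoeff (N x k)
  have hMN : M0 * N0 = 1 := by
    ext k l
    have key := h (fun j => ∑ x : G, M k x * N x j - if j = k then 1 else 0) (by
      simp only [sub_mul, Finset.sum_sub_distrib, Finset.sum_mul, ite_mul, one_mul, zero_mul]
      rw [Finset.sum_comm]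
      simp only [mul_assoc, ← Finset.mul_sum, hN]
      rw [Finset.sum_ite_eq' T (k : ℕ), if_pos k.2, Finset.sum_coe_sort G (fun x => M k x * x), hM,
        sub_self]) l l.2
    simp only [map_sub, map_sum, map_mul] at key
    rw [Matrix.mul_apply, sub_eq_zero.1 key, Matrix.one_apply]
    by_cases hkl : k = l
    · simp [hkl]
    · have : (l : ℕ) ≠ k := fun e => hkl (Subtype.ext e.symm)
      simp [hkl, this]
  have hr := Matrix.rank_mul_le_left M0 N0
  rw [hMN, Matrix.rank_one] at hr
  simpa using hr.trans (Matrix.rank_le_card_width M0)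

lemma inf_eq_span (S : Staircase) (KA KB : Finset ℕ)
    (hUnion : KA ∪ KB = Finset.Iic S.r) (hDisj : Disjoint KA KB) :
    Ideal.span (stairGen S '' ↑KA) ⊓ Ideal.span (stairGen S '' ↑KB) =
      Ideal.span (S.L '' ↑((Finset.range S.r).filter fun k => ¬((k ∈ KA) ↔ (k + 1 ∈ KA)))) := by
  classical
  have hmem : ∀ k, k ≤ S.r ↔ k ∈ KA ∨ k ∈ KB := by
    intro k; rw [← Finset.mem_union, hUnion, Finset.mem_Iic]
  apply le_antisymm
  · rintro z ⟨hzA, hzB⟩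
    obtain ⟨a, ha⟩ := (Submodule.mem_span_image_finset_iff_exists_fun' R).1 hzA
    obtain ⟨b, hb⟩ := (Submodule.mem_span_image_finset_iff_exists_fun' R).1 hzB
    have hsub : Finset.range (S.r + 1) = KA ∪ KB := by
      rw [hUnion]; ext; simp
    have hBA : ∀ k ∈ KB, k ∉ KA := fun k hk hk' => Finset.disjoint_left.1 hDisj hk' hk
    have key := S.syz_part KA S.r le_rfl (fun k => if k ∈ KA then a k else - b k) (by
      rw [hsub, Finset.sum_union hDisj,
        Finset.sum_congr rfl (g := fun k => a k • stairGen S k)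
          (fun k hk => by simp [hk]), ha,
        Finset.sum_congr rfl (g := fun k => - (b k • stairGen S k))
          (fun k hk => by simp [hBA k hk]), Finset.sum_neg_distrib, hb, add_neg_cancel])
    rw [hsub, Finset.sum_union hDisj,
        Finset.sum_congr rfl (g := fun k => a k • stairGen S k)
          (fun k hk => by simp [hk]), ha,
        Finset.sum_eq_zero (s := KB) (fun k hk => by simp [hBA k hk]), add_zero] at key
    exact key
  · rw [Ideal.span_le]
    rintro _ ⟨k, hk, rfl⟩
    simp only [Finset.coe_filter, Finset.mem_range, Set.mem_ofPred_eq] at hk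
    obtain ⟨hk, hcut⟩ := hk
    have d0 := S.gen_dvd_L hk
    have d1 := S.gen_succ_dvd_L hk
    have m0 := (hmem k).1 hk.le
    have m1 := (hmem (k + 1)).1 hk
    have fin : ∀ (K : Finset ℕ) (l : ℕ), l ∈ K → stairGen S l ∣ S.L k →
        S.L k ∈ Ideal.span (stairGen S '' ↑K) := fun K l hl hd =>
      Ideal.mem_of_dvd _ hd (Ideal.subset_span ⟨l, hl, rfl⟩)
    refine ⟨?_, ?_⟩
    · by_cases h : k ∈ KA
      · exact fin _ _ h d0
      · exact fin _ (k + 1) (by tauto) d1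
    · by_cases h : k ∈ KA
      · exact fin _ (k + 1) (by tauto) d1
      · exact fin _ k (by tauto) d0

/-- Theorem 5.4: for a partition {f₀,…,f_r} = A ⊔ B of the staircase generators into
two nonempty sets (encoded by index sets KA ⊔ KB = {0,…,r}) with cut number c, the
ideal span A ⊓ span B is minimally generated by exactly c elements: μ(J ⊓ K) = c. -/
theorem statement11 (S : Staircase) (KA KB : Finset ℕ)
    (hUnion : KA ∪ KB = Finset.Iic S.r) (hDisj : Disjoint KA KB)
    (hAne : KA.Nonempty) (hBne : KB.Nonempty) :
    mu (Ideal.span (stairGen S '' ↑KA) ⊓ Ideal.span (stairGen S '' ↑KB)) =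
      ((Finset.range S.r).filter fun k => ¬((k ∈ KA) ↔ (k + 1 ∈ KA))).card := by
  classical
  rw [inf_eq_span S KA KB hUnion hDisj]
  set T := (Finset.range S.r).filter fun k => ¬((k ∈ KA) ↔ (k + 1 ∈ KA)) with hTdef
  have hT : ∀ k ∈ T, k < S.r := fun k hk => by
    rw [hTdef, Finset.mem_filter, Finset.mem_range] at hk; exact hk.1
  have hinj : Set.InjOn S.L ↑T := by
    intro k hk l hl hkl
    by_contra hne
    have := S.const_zero T hT (fun j => (if j = k then 1 else 0) - if j = l then 1 else 0)
      (by
        simp only [sub_mul, ite_mul, one_mul, zero_mul, Finset.sum_sub_distrib]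
        rw [Finset.sum_ite_eq' T k, Finset.sum_ite_eq' T l, if_pos (Finset.mem_coe.1 hk), if_pos (Finset.mem_coe.1 hl), hkl, sub_self])
      hk
    simp [hne] at this
  unfold mu
  apply le_antisymm
  · exact Nat.sInf_le ⟨T.image S.L, Finset.card_image_of_injOn hinj, by rw [Finset.coe_image]⟩
  · refine le_csInf ⟨_, T.image S.L, rfl, by rw [Finset.coe_image]⟩ ?_
    rintro n ⟨G, rfl, hG⟩
    exact card_le_of_const_zero T S.L (fun g hg k hk => S.const_zero T hT g hg hk) G hG
end
end
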